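/- For all integers n ≥ 1 and 1 ≤ s ≤ n, ∑_{i=0}^{n−s} a_{n, n−i} · c_{n−i, s} equals (2n−1)! if s = n, and equals 0 if 1 ≤ s ≤ n−1. Equivalently, the lower-triangular matrices A = (a_{i,j}) and C = (c_{i,j}) of size n satisfy A·C = diag(1!, 3!, …, (2n−1)!). -/

import Mathlib

open Finset Filter Real

/-- The number of cyclic descents of a permutation `σ` of `{0, …, n-1}`, read cyclically:
positions `i` with `σ(i) > σ(i+1)`, indices mod `n`. -/
def cyclicDescents (n : ℕ) (σ : Equiv.Perm (Fin n)) : ℕ :=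
  (Finset.univ.filter (fun i : Fin n => σ (finRotate n i) < σ i)).card

/-- The circular Eulerian number `Ā(n,l)`: the number of circular `n`-permutations with exactly
`l` descents.  Each circular permutation has exactly `n` linear representatives (all with the
same number of cyclic descents), whence the division by `n`. -/
def circEulerian (n l : ℕ) : ℕ :=
  (Finset.univ.filter (fun σ : Equiv.Perm (Fin n) => cyclicDescents n σ = l)).card / n

/-- The coefficient `t(k,i) = (-1)^(k-i) 2^(2i) (k/(k+i)) C(k+i, k-i)` of the Chebyshev
polynomial of the first kind, with the convention `t(0,0) = 1/2`. -/
noncomputable def tCoeff (k i : ℕ) : ℝ :=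
  if k = 0 ∧ i = 0 then 1 / 2
  else (-1) ^ (k - i) * 2 ^ (2 * i) * ((k : ℝ) / ((k : ℝ) + (i : ℝ))) *
    (Nat.choose (k + i) (k - i) : ℝ)

/-- The coefficient `u(k,i) = (-1)^(k-i) 2^(2i) C(k+i, k-i)` of the Chebyshev polynomial of the
second kind. -/
noncomputable def uCoeff (k i : ℕ) : ℝ :=
  (-1) ^ (k - i) * 2 ^ (2 * i) * (Nat.choose (k + i) (k - i) : ℝ)

/-- `a_{n,i} = 2 ∑_{l=1}^{i} (-1)^(n-l) t(n-l, n-i) Ā(2n, l)`. -/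
noncomputable def aCoeff (n i : ℕ) : ℝ :=
  2 * ∑ l ∈ Finset.Icc 1 i, (-1) ^ (n - l) * tCoeff (n - l) (n - i) *
    (circEulerian (2 * n) l : ℝ)

/-- `b_{n,i} = ∑_{l=1}^{i} (-1)^(n-l) u(n-l, n-i) Ā(2n+1, l)`. -/
noncomputable def bCoeff (n i : ℕ) : ℝ :=
  ∑ l ∈ Finset.Icc 1 i, (-1) ^ (n - l) * uCoeff (n - l) (n - i) *
    (circEulerian (2 * n + 1) l : ℝ)

/-- Full cycle. -/
def FullCyc {α : Type} (c : Equiv.Perm α) : Prop :=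
  ∀ s : Set α, s.Nonempty → (∀ a ∈ s, c a ∈ s) → s = Set.univ

def dsc {α : Type} [Fintype α] [LinearOrder α] (c : Equiv.Perm α) : ℕ :=
  (Finset.univ.filter (fun a : α => c a < a)).card

lemma fullCyc_option {α : Type} [DecidableEq α] (i : α) (c : Equiv.Perm α) :
    FullCyc (Equiv.Perm.decomposeOption.symm (some i, c)) ↔ FullCyc c := by
  have h1 : ∀ a, c a = i → (Equiv.Perm.decomposeOption.symm (some i, c)) (some a) = none := by
    intro a h
    simp [h]
  have h2 : ∀ a, c a ≠ i →
      (Equiv.Perm.decomposeOption.symm (some i, c)) (some a) = some (c a) := by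
    intro a h
    simp
    rw [Equiv.swap_apply_of_ne_of_ne] <;> simp [h]
  have h3 : (Equiv.Perm.decomposeOption.symm (some i, c)) none = some i := by simp
  generalize (Equiv.Perm.decomposeOption.symm (some i, c)) = c' at *
  constructor
  · intro h s hs hinv
    have := h {o | (∃ a ∈ s, o = some a) ∨ (o = none ∧ i ∈ s)} ?_ ?_
    · ext a
      have ha : some a ∈ (Set.univ : Set (Option α)) := trivial
      rw [← this] at ha
      simpa using ha
    · obtain ⟨a, ha⟩ := hs
      exact ⟨some a, Or.inl ⟨a, ha, rfl⟩⟩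
    · rintro o (⟨a, ha, rfl⟩ | ⟨rfl, hi⟩)
      · have := hinv a ha
        by_cases hc : c a = i
        · rw [h1 a hc]; right; exact ⟨rfl, hc ▸ this⟩
        · rw [h2 a hc]; left; exact ⟨_, this, rfl⟩
      · rw [h3]; left; exact ⟨_, hi, rfl⟩
  · intro h s hs hinv
    have hs0 : {a | some a ∈ s} = Set.univ := by
      apply h
      · obtain ⟨o, ho⟩ := hs
        cases o with
        | none => exact ⟨i, by simpa [h3] using hinv _ ho⟩
        | some a => exact ⟨a, ho⟩
      · intro a ha
        have := hinv _ ha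
        by_cases hc : c a = i
        · rw [h1 a hc] at this
          have := hinv _ this
          rw [h3] at this
          rw [hc]; exact this
        · rw [h2 a hc] at this; exact this
    have hh : ∀ a, some a ∈ s := fun a => by
      have : a ∈ (Set.univ : Set α) := trivial
      rw [← hs0] at this; exact this
    ext o
    cases o with
    | none => 
      have := hinv _ (hh (c.symm i))
      rw [h1 _ (by simp)] at this
      simp [this]
    | some a => simp [hh a]

lemma not_fullCyc_none {α : Type} [DecidableEq α] [Nonempty α] (c : Equiv.Perm α) :
    ¬ FullCyc (Equiv.Perm.decomposeOption.symm (none, c)) := by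
  intro h
  have := h {none} ⟨none, rfl⟩ (by simp)
  have h2 : some (Classical.arbitrary α) ∈ ({none} : Set (Option α)) := by rw [this]; trivial
  simp at h2

lemma dsc_option {α : Type} [Fintype α] [LinearOrder α] (a : α) (c : Equiv.Perm α) :
    dsc (α := WithTop α) (Equiv.Perm.decomposeOption.symm (some (c a), c)) =
      if c a < a then dsc c else dsc c + 1 := by
  have h1 : (Equiv.Perm.decomposeOption.symm (some (c a), c)) (some a) = none := by
    simp
  have h2 : ∀ b, b ≠ a →
      (Equiv.Perm.decomposeOption.symm (some (c a), c)) (some b) = some (c b) := by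
    intro b h
    simp
    rw [Equiv.swap_apply_of_ne_of_ne] <;> simp [h]
  have h3 : (Equiv.Perm.decomposeOption.symm (some (c a), c)) none = some (c a) := by simp
  generalize (Equiv.Perm.decomposeOption.symm (some (c a), c)) = c' at *
  classical
  have key : dsc (α := WithTop α) c' =
      ∑ b : Option α, if @LT.lt (WithTop α) _ (c' b) b then 1 else 0 := by
    unfold dsc
    rw [Finset.card_filter]
    refine Finset.sum_congr rfl (fun b _ => ?_)
    congr 1
  rw [key, Fintype.sum_option]
  have e1 : (if @LT.lt (WithTop α) _ (c' none) none then 1 else 0) = 1 := by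
    rw [h3, if_pos]; exact WithTop.coe_lt_top _
  have e2 : ∀ b, (if @LT.lt (WithTop α) _ (c' (some b)) (some b) then 1 else 0) = 
    if b = a then 0 else (if c b < b then 1 else 0) := by
    intro b
    by_cases hb : b = a
    · subst hb
      rw [h1, if_pos rfl, if_neg]; exact not_top_lt
    · rw [h2 b hb, if_neg hb]
      congr 1
      exact propext WithTop.coe_lt_coe
  rw [e1, Finset.sum_congr rfl (fun b _ => e2 b)]
  unfold dsc
  rw [Finset.card_filter, ← Finset.add_sum_erase _ _ (Finset.mem_univ a), ← Finset.add_sum_erase _ (fun i => if c i < i then 1 else 0) (Finset.mem_univ a), if_pos rfl]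
  rw [Finset.sum_congr rfl (fun b hb => if_neg (Finset.ne_of_mem_erase hb))]
  split_ifs <;> omega

open Classical in
noncomputable def Wsum (α : Type) [Fintype α] [LinearOrder α] (φ : ℕ → ℝ) : ℝ :=
  ∑ c : Equiv.Perm α, if FullCyc c then φ (dsc c) else 0

lemma fullCyc_permCongr {α β : Type} (e : α ≃ β) (c : Equiv.Perm α) (h : FullCyc c) :
    FullCyc (e.permCongr c) := by
  intro s hs hinv
  have := h (e ⁻¹' s) ?_ ?_
  · ext b
    have : e.symm b ∈ e ⁻¹' s := by rw [this]; trivial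
    simpa using this
  · obtain ⟨b, hb⟩ := hs
    exact ⟨e.symm b, by simpa using hb⟩
  · intro a ha
    simpa using hinv _ ha

lemma dsc_permCongr {α β : Type} [Fintype α] [LinearOrder α] [Fintype β] [LinearOrder β]
    (e : α ≃o β) (c : Equiv.Perm α) : dsc (e.toEquiv.permCongr c) = dsc c := by
  unfold dsc
  symm
  apply Finset.card_bij (fun a _ => e a)
  · intro a ha
    rw [Finset.mem_filter] at ha ⊢
    simpa using ha
  · intro a _ b _ h; simpa using h
  · intro b hb
    refine ⟨e.symm b, ?_, by simp⟩
    rw [Finset.mem_filter] at hb ⊢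
    refine ⟨Finset.mem_univ _, ?_⟩
    replace hb := hb.2
    rw [← e.lt_iff_lt]; simpa using hb

lemma Wsum_congr {α β : Type} [Fintype α] [LinearOrder α] [Fintype β] [LinearOrder β]
    (e : α ≃o β) (φ : ℕ → ℝ) : Wsum α φ = Wsum β φ := by
  unfold Wsum
  apply Fintype.sum_equiv e.toEquiv.permCongr
  intro c
  rw [dsc_permCongr]
  congr 1
  refine propext ⟨fullCyc_permCongr _ c, fun h => ?_⟩
  have := fullCyc_permCongr e.toEquiv.symm _ h
  convert this
  ext; simp

lemma Wsum_withTop {α : Type} [Fintype α] [LinearOrder α] [Nonempty α] (φ : ℕ → ℝ) :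
    Wsum (WithTop α) φ =
      Wsum α (fun d => d * φ d + ((Fintype.card α : ℝ) - d) * φ (d + 1)) := by
  classical
  unfold Wsum
  have := (Equiv.sum_comp (Equiv.Perm.decomposeOption (α := α)).symm
    (fun c => if FullCyc c then φ (dsc (α := WithTop α) c) else 0)).symm
  refine Eq.trans ?_ (this.trans ?_)
  · apply Finset.sum_bij (fun c _ => c)
    · intro _ _; exact Finset.mem_univ _
    · intro _ _ _ _ h; exact h
    · intro b _; exact ⟨b, Finset.mem_univ _, rfl⟩
    · intro c _; rfl
  rw [Fintype.sum_prod_type, Fintype.sum_option, Finset.sum_eq_zero, zero_add, Finset.sum_comm]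
  · apply Finset.sum_congr rfl
    intro c _
    simp_rw [fullCyc_option]
    split_ifs with h
    · rw [← Equiv.sum_comp c]
      have : ∀ a, φ (dsc (α := WithTop α) (Equiv.Perm.decomposeOption.symm (some (c a), c))) =
        if c a < a then φ (dsc c) else φ (dsc c + 1) := by
        intro a
        rw [dsc_option]; split_ifs <;> rfl
      rw [Finset.sum_congr rfl (fun a _ => this a), Finset.sum_ite, Finset.sum_const,
        Finset.sum_const, nsmul_eq_mul, nsmul_eq_mul]
      congr 2
      have := Finset.card_filter_add_card_filter_not (s := (Finset.univ : Finset α)) (fun a => c a < a)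
      rw [Finset.card_univ] at this
      rw [← this]
      unfold dsc
      push_cast
      ring
    · simp
  · intro c _
    rw [if_neg (not_fullCyc_none c)]

noncomputable abbrev WF (m : ℕ) (φ : ℕ → ℝ) : ℝ := Wsum (Fin m) φ

lemma WF_succ (m : ℕ) (hm : 1 ≤ m) (φ : ℕ → ℝ) :
    WF (m + 1) φ = WF m (fun d => d * φ d + ((m : ℝ) - d) * φ (d + 1)) := by
  have : Nonempty (Fin m) := ⟨⟨0, hm⟩⟩
  have e := Fintype.orderIsoFinOfCardEq (WithTop (Fin m)) (k := m + 1)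
    (by exact (Fintype.card_option).trans (by simp))
  rw [WF, Wsum_congr e, Wsum_withTop]
  simp

lemma WF_one (φ : ℕ → ℝ) : WF 1 φ = φ 0 := by
  unfold WF Wsum
  rw [Fintype.sum_unique, if_pos]
  · congr 1
  · intro s hs _
    exact Subsingleton.eq_univ_of_nonempty hs

lemma WF_const (m : ℕ) : WF (m + 1) (fun _ => 1) = (Nat.factorial m : ℝ) := by
  induction m with
  | zero => simpa using WF_one _
  | succ m ih =>
    rw [WF_succ _ (by omega)]
    have : (fun d : ℕ => (d : ℝ) * 1 + (((m + 1 : ℕ) : ℝ) - d) * 1) =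
        fun d => ((m + 1 : ℕ) : ℝ) * 1 := by
      ext d; ring
    rw [this, Nat.factorial_succ, Nat.cast_mul, ← ih]
    unfold WF Wsum
    rw [Finset.mul_sum]
    apply Finset.sum_congr rfl
    intro c _
    split_ifs <;> simp

lemma WF_symm (m : ℕ) (hm : 2 ≤ m) : ∀ φ : ℕ → ℝ, WF m φ = WF m (fun d => φ (m - d)) := by
  induction m, hm using Nat.le_induction with
  | base =>
    intro φ
    rw [WF_succ 1 le_rfl, WF_succ 1 le_rfl, WF_one, WF_one]
    simp
  | succ m hm ih =>
    intro φ
    rw [WF_succ m (by omega), WF_succ m (by omega), ih]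
    unfold WF Wsum
    apply Finset.sum_congr rfl
    intro c _
    have hd : dsc c ≤ m := by
      unfold dsc
      exact (Finset.card_le_univ _).trans (by simp)
    generalize dsc c = d at *
    split_ifs
    · beta_reduce
      rw [Nat.cast_sub hd, show m - d + 1 = m + 1 - d by omega, show m + 1 - (d + 1) = m - d by omega]
      ring
    · rfl

open Classical in
lemma WF_card (n l : ℕ) : WF n (fun d => if d = l then 1 else 0) =
    (((Finset.univ.filter (fun c : Equiv.Perm (Fin n) => FullCyc c ∧ dsc c = l)).card : ℕ) : ℝ) := by
  unfold WF Wsum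
  rw [Finset.card_filter]
  push_cast
  apply Finset.sum_congr rfl
  intro c _
  by_cases h : FullCyc c <;> by_cases h' : dsc c = l <;> simp [h, h']

open Classical in
lemma card_full (m : ℕ) :
    (Finset.univ.filter (fun c : Equiv.Perm (Fin (m + 1)) => FullCyc c)).card = Nat.factorial m := by
  have := WF_const m
  unfold WF Wsum at this
  rw [Finset.sum_ite] at this
  simp at this
  exact_mod_cast this

open scoped Fin.NatCast in
lemma fullCyc_finRotate (m : ℕ) : FullCyc (finRotate (m + 1)) := by
  intro s hs hinv
  obtain ⟨a, ha⟩ := hs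
  have key : ∀ k : ℕ, a + (k : Fin (m + 1)) ∈ s := by
    intro k
    induction k with
    | zero => simpa using ha
    | succ k ih =>
      have := hinv _ ih
      rw [finRotate_apply] at this
      simpa [add_assoc] using this
  ext b
  have := key ((b - a : Fin (m + 1)) : ℕ)
  simpa using this

lemma dsc_conj (m : ℕ) (σ : Equiv.Perm (Fin m)) :
    dsc (σ.permCongr (finRotate m)) = cyclicDescents m σ := by
  unfold dsc cyclicDescents
  symm
  apply Finset.card_bij (fun a _ => σ a)
  · intro a ha
    rw [Finset.mem_filter] at ha ⊢
    simpa using ha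
  · intro a _ b _ h; simpa using h
  · intro b hb
    rw [Finset.mem_filter] at hb
    refine ⟨σ.symm b, ?_, by simp⟩
    rw [Finset.mem_filter]
    simpa using hb

open scoped Fin.NatCast in
lemma conj_inj (m : ℕ) (σ τ : Equiv.Perm (Fin (m + 1)))
    (h : σ.permCongr (finRotate (m + 1)) = τ.permCongr (finRotate (m + 1)))
    (h0 : σ 0 = τ 0) : σ = τ := by
  have key : ∀ k : ℕ, σ (k : Fin (m + 1)) = τ (k : Fin (m + 1)) := by
    intro k
    induction k with
    | zero => simpa using h0
    | succ k ih =>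
      have h1 := congrArg (fun f => f (σ (k : Fin (m + 1)))) h
      simp only [Equiv.permCongr_apply, Equiv.symm_apply_apply] at h1
      rw [ih, Equiv.symm_apply_apply, finRotate_apply] at h1
      simpa using h1
  ext1 b
  simpa using key b

open Classical in
lemma card_link (m l : ℕ) :
    (Finset.univ.filter (fun σ : Equiv.Perm (Fin (m + 1)) => cyclicDescents (m + 1) σ = l)).card =
    (Finset.univ.filter (fun c : Equiv.Perm (Fin (m + 1)) => FullCyc c ∧ dsc c = l)).card * (m + 1) := by
  let f : Equiv.Perm (Fin (m + 1)) → {c : Equiv.Perm (Fin (m + 1)) // FullCyc c} × Fin (m + 1) :=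
    fun σ => (⟨σ.permCongr (finRotate (m + 1)), fullCyc_permCongr _ _ (fullCyc_finRotate m)⟩, σ 0)
  have hf : Function.Bijective f := by
    rw [Fintype.bijective_iff_injective_and_card]
    constructor
    · intro σ τ h
      simp only [f, Prod.mk.injEq, Subtype.mk.injEq] at h
      exact conj_inj m σ τ h.1 h.2
    · rw [Fintype.card_prod, Fintype.card_subtype, card_full, Fintype.card_perm, Fintype.card_fin,
        Nat.factorial_succ, mul_comm]
  have h2 : (Finset.univ.filter (fun c : Equiv.Perm (Fin (m + 1)) => FullCyc c ∧ dsc c = l)).card * (m + 1) =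
    ((Finset.univ.filter (fun c : Equiv.Perm (Fin (m + 1)) => FullCyc c ∧ dsc c = l)) ×ˢ (Finset.univ : Finset (Fin (m + 1)))).card := by
    rw [Finset.card_product]; simp
  rw [h2]
  apply Finset.card_bij (fun σ _ => (((f σ).1 : Equiv.Perm (Fin (m + 1))), (f σ).2))
  · intro σ hσ
    rw [Finset.mem_filter] at hσ
    rw [Finset.mem_product, Finset.mem_filter]
    exact ⟨⟨Finset.mem_univ _, (f σ).1.2, (dsc_conj _ σ).trans hσ.2⟩, Finset.mem_univ _⟩
  · intro σ _ τ _ h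
    apply hf.1
    simp only [Prod.mk.injEq] at h
    exact Prod.ext (Subtype.ext h.1) h.2
  · rintro ⟨c, x⟩ hc
    rw [Finset.mem_product, Finset.mem_filter] at hc
    obtain ⟨⟨-, h1, h2⟩, -⟩ := hc
    obtain ⟨σ, hσ⟩ := hf.2 (⟨c, h1⟩, x)
    refine ⟨σ, ?_, by rw [hσ]⟩
    rw [Finset.mem_filter]
    refine ⟨Finset.mem_univ _, ?_⟩
    rw [← dsc_conj, ← h2]
    have := congrArg (fun p => (p.1 : Equiv.Perm (Fin (m + 1)))) hσ
    exact congrArg dsc this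

lemma circEulerian_eq (m l : ℕ) (hm : 1 ≤ m) :
    (circEulerian m l : ℝ) = WF m (fun d => if d = l then 1 else 0) := by
  obtain ⟨m, rfl⟩ : ∃ k, m = k + 1 := ⟨m - 1, by omega⟩
  rw [WF_card]
  unfold circEulerian
  rw [card_link, Nat.mul_div_cancel _ (by omega)]

lemma circEulerian_zero (m : ℕ) (hm : 2 ≤ m) : (circEulerian m 0 : ℝ) = 0 := by
  rw [circEulerian_eq m 0 (by omega)]
  obtain ⟨m, rfl⟩ : ∃ k, m = k + 1 := ⟨m - 1, by omega⟩
  rw [WF_succ _ (by omega)]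
  unfold WF Wsum
  apply Finset.sum_eq_zero
  intro c _
  by_cases h : dsc c = 0 <;> simp [h]

lemma circEulerian_symm (m l : ℕ) (hm : 2 ≤ m) (hl : l ≤ m) :
    (circEulerian m l : ℝ) = circEulerian m (m - l) := by
  rw [circEulerian_eq m _ (by omega), circEulerian_eq m _ (by omega), WF_symm m hm]
  unfold WF Wsum
  apply Finset.sum_congr rfl
  intro c _
  have hd : dsc c ≤ m := by
    unfold dsc
    exact (Finset.card_le_univ _).trans (by simp)
  have : (m - dsc c = l) ↔ dsc c = m - l := by omega
  simp only [this]

lemma WF_eq_sum (m : ℕ) (hm : 1 ≤ m) (φ : ℕ → ℝ) :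
    WF m φ = ∑ l ∈ Finset.range (m + 1), (circEulerian m l : ℝ) * φ l := by
  simp_rw [circEulerian_eq m _ hm]
  unfold WF Wsum
  simp_rw [Finset.sum_mul]
  rw [Finset.sum_comm]
  apply Finset.sum_congr rfl
  intro c _
  have hd : dsc c ≤ m := by
    unfold dsc
    exact (Finset.card_le_univ _).trans (by simp)
  split_ifs
  · simp [hd]
  · simp

/-- folding -/
lemma WF_even (n : ℕ) (hn : 1 ≤ n) (φ : ℕ → ℝ) (hφ : ∀ l ≤ 2 * n, φ (2 * n - l) = φ l) :
    WF (2 * n) φ = circEulerian (2 * n) n * φ n +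
      2 * ∑ l ∈ Finset.Ico 1 n, (circEulerian (2 * n) l : ℝ) * φ l := by
  rw [WF_eq_sum _ (by omega), Finset.range_eq_Ico]
  rw [← Finset.sum_Ico_consecutive _ (show 0 ≤ n by omega) (show n ≤ 2 * n + 1 by omega),
    Finset.sum_eq_sum_Ico_succ_bot (show n < 2 * n + 1 by omega),
    Finset.sum_eq_sum_Ico_succ_bot (show 0 < n by omega), circEulerian_zero _ (by omega)]
  have h2 : ∑ l ∈ Finset.Ico (n + 1) (2 * n + 1), (circEulerian (2 * n) l : ℝ) * φ l =
      ∑ l ∈ Finset.Ico 0 n, (circEulerian (2 * n) l : ℝ) * φ l := by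
    apply Finset.sum_bij' (fun l _ => 2 * n - l) (fun l _ => 2 * n - l)
    · intro l hl; simp at hl ⊢; omega
    · intro l hl; simp at hl ⊢; omega
    · intro l hl; simp at hl ⊢; omega
    · intro l hl; simp at hl ⊢; omega
    · intro l hl
      simp at hl
      rw [hφ l (by omega), ← circEulerian_symm _ _ (by omega) (by omega)]
  rw [h2, Finset.sum_eq_sum_Ico_succ_bot (show 0 < n by omega), circEulerian_zero _ (by omega)]
  ring

noncomputable def Hf (m : ℕ) (x : ℝ) : ℝ := WF m (fun d => cos (((m : ℝ) - 2 * d) * x)) / sin x ^ m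

lemma Hf_deriv (m : ℕ) (hm : 1 ≤ m) (x : ℝ) (hx : sin x ≠ 0) :
    HasDerivAt (Hf m) (- Hf (m + 1) x) x := by
  have h1 : HasDerivAt (fun x => WF m (fun d => cos (((m : ℝ) - 2 * d) * x)))
      (WF m (fun d => - sin (((m : ℝ) - 2 * d) * x) * ((m : ℝ) - 2 * d))) x := by
    unfold WF Wsum
    apply HasDerivAt.fun_sum
    intro c _
    split_ifs
    · have h := ((hasDerivAt_id x).const_mul ((m : ℝ) - 2 * (dsc c : ℝ))).cos
      simpa using h
    · exact hasDerivAt_const _ _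
  have h2 := (hasDerivAt_sin x).pow m
  have h3 := h1.div h2 (pow_ne_zero _ hx)
  refine h3.congr_deriv ?_
  obtain ⟨k, rfl⟩ : ∃ k, m = k + 1 := ⟨m - 1, by omega⟩
  have key : WF (k + 1) (fun d => - sin ((((k + 1 : ℕ) : ℝ) - 2 * d) * x) * (((k + 1 : ℕ) : ℝ) - 2 * d)) * sin x
      - (k + 1 : ℕ) * cos x * WF (k + 1) (fun d => cos ((((k + 1 : ℕ) : ℝ) - 2 * d) * x))
      = - WF (k + 1 + 1) (fun d => cos ((((k + 1 + 1 : ℕ) : ℝ) - 2 * d) * x)) := by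
    rw [WF_succ _ hm]
    unfold WF Wsum
    rw [Finset.sum_mul, Finset.mul_sum, ← Finset.sum_sub_distrib, ← Finset.sum_neg_distrib]
    apply Finset.sum_congr rfl
    intro c _
    generalize dsc c = d
    split_ifs
    · have e1 : (((k + 1 + 1 : ℕ) : ℝ) - 2 * d) * x = (((k + 1 : ℕ) : ℝ) - 2 * d) * x + x := by
        push_cast; ring
      have e2 : (((k + 1 + 1 : ℕ) : ℝ) - 2 * (d + 1 : ℕ)) * x = (((k + 1 : ℕ) : ℝ) - 2 * d) * x - x := by
        push_cast; ring
      beta_reduce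
      rw [e1, e2, cos_add, cos_sub]
      ring
    · simp
  unfold Hf
  rw [← neg_div, ← key]
  rw [Nat.add_sub_cancel, Pi.pow_apply]
  generalize WF (k + 1) _ = A
  generalize WF (k + 1) _ = B
  field_simp
  ring

lemma dslope_an (f : ℝ → ℝ) (hf : AnalyticAt ℝ f 0) : AnalyticAt ℝ (dslope f 0) 0 := by
  obtain ⟨p, hp⟩ := hf
  exact ⟨_, hp.has_fpower_series_dslope_fslope⟩

lemma sin_ev : ∀ᶠ x in nhdsWithin (0 : ℝ) {0}ᶜ, sin x ≠ 0 := by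
  rw [eventually_nhdsWithin_iff]
  filter_upwards [Ioo_mem_nhds (show -π < 0 by linarith [pi_pos]) pi_pos] with x hx h0
  rcases lt_or_gt_of_ne h0 with h | h
  · exact (sin_neg_of_neg_of_neg_pi_lt h hx.1).ne
  · exact (sin_pos_of_pos_of_lt_pi h hx.2).ne'

lemma Hf_laurent (m : ℕ) : ∃ g : ℝ → ℝ, AnalyticAt ℝ g 0 ∧
    ∀ᶠ x in nhdsWithin (0 : ℝ) {0}ᶜ, Hf (m + 1) x = (Nat.factorial m : ℝ) / x ^ (m + 1) + g x := by
  induction m with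
  | zero =>
    have hS : AnalyticAt ℝ (dslope sin 0) 0 := dslope_an _ analyticAt_sin
    have hS0 : dslope sin 0 0 = 1 := by simp [dslope_same]
    have hD : AnalyticAt ℝ (fun x => cos x - dslope sin 0 x) 0 := analyticAt_cos.sub hS
    refine ⟨fun x => dslope (fun x => cos x - dslope sin 0 x) 0 x / dslope sin 0 x,
      (dslope_an _ hD).div hS (by rw [hS0]; norm_num), ?_⟩
    filter_upwards [sin_ev, self_mem_nhdsWithin] with x hx hx0
    have hx0' : x ≠ 0 := hx0
    have e1 : dslope sin 0 x = sin x / x := by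
      rw [dslope_of_ne _ hx0', slope_def_field]; simp
    have e2 : dslope (fun x => cos x - dslope sin 0 x) 0 x = (cos x - sin x / x) / x := by
      rw [dslope_of_ne _ hx0', slope_def_field, hS0, e1]; simp
    rw [e2, e1]
    unfold Hf
    rw [WF_one]
    simp
    field_simp
    ring
  | succ m ih =>
    obtain ⟨g, hg, hev⟩ := ih
    refine ⟨fun x => - deriv g x, hg.deriv.neg, ?_⟩
    rw [eventually_nhdsWithin_iff] at hev
    have hev2 := hev.eventually_nhds
    have hgan := hg.eventually_analyticAt
    filter_upwards [sin_ev, self_mem_nhdsWithin, hev2.filter_mono nhdsWithin_le_nhds,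
      hgan.filter_mono nhdsWithin_le_nhds] with x hx hx0 he hga
    have hx0' : x ≠ 0 := hx0
    have hd1 := Hf_deriv (m + 1) (by omega) x hx
    have hd2 : HasDerivAt (fun x => (Nat.factorial m : ℝ) / x ^ (m + 1) + g x)
      (-((Nat.factorial (m + 1) : ℕ) : ℝ) / x ^ (m + 1 + 1) + deriv g x) x := by
      apply HasDerivAt.add _ hga.differentiableAt.hasDerivAt
      have := (hasDerivAt_const x (Nat.factorial m : ℝ)).div (hasDerivAt_pow (m + 1) x) (pow_ne_zero _ hx0')
      refine this.congr_deriv ?_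
      rw [Nat.factorial_succ, Nat.add_sub_cancel]
      push_cast
      field_simp
      ring
    have hd3 : HasDerivAt (fun x => (Nat.factorial m : ℝ) / x ^ (m + 1) + g x)
      (- Hf (m + 1 + 1) x) x := by
      apply hd1.congr_of_eventuallyEq
      filter_upwards [he, isOpen_compl_singleton.mem_nhds hx0'] with y hy hy0
      exact (hy hy0).symm
    have := hd2.unique hd3
    rw [← neg_eq_iff_eq_neg] at this
    rw [← this]; ring

lemma laurent_unique (n : ℕ) (B : ℕ → ℝ) (L : ℝ)
    (h : Tendsto (fun x : ℝ => ∑ s ∈ Finset.range (n + 1), B s / x ^ (2 * s))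
      (nhdsWithin 0 {0}ᶜ) (nhds L)) : ∀ s, 1 ≤ s → s ≤ n → B s = 0 := by
  induction n with
  | zero => intro s h1 h2; omega
  | succ n ih =>
    have hB : B (n + 1) = 0 := by
      have h0 : Tendsto (fun x : ℝ => x ^ (2 * (n + 1))) (nhdsWithin 0 {0}ᶜ) (nhds 0) := by
        have : Tendsto (fun x : ℝ => x ^ (2 * (n + 1))) (nhds 0) (nhds (0 ^ (2 * (n + 1)))) :=
          (continuous_pow _).tendsto _
        rw [zero_pow (by omega)] at this
        exact this.mono_left nhdsWithin_le_nhds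
      have h1 := h0.mul h
      rw [zero_mul] at h1
      have h2 : Tendsto (fun x : ℝ => ∑ s ∈ Finset.range (n + 1 + 1), B s * x ^ (2 * (n + 1 - s)))
          (nhdsWithin 0 {0}ᶜ) (nhds (∑ s ∈ Finset.range (n + 1 + 1), B s * 0 ^ (2 * (n + 1 - s)))) := by
        apply Tendsto.mono_left _ nhdsWithin_le_nhds
        apply Continuous.tendsto
        fun_prop
      have h3 : (fun x : ℝ => x ^ (2 * (n + 1)) * ∑ s ∈ Finset.range (n + 1 + 1), B s / x ^ (2 * s))
        =ᶠ[nhdsWithin 0 {0}ᶜ] (fun x : ℝ => ∑ s ∈ Finset.range (n + 1 + 1), B s * x ^ (2 * (n + 1 - s))) := by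
        filter_upwards [self_mem_nhdsWithin] with x hx
        have hx' : x ≠ 0 := hx
        rw [Finset.mul_sum]
        apply Finset.sum_congr rfl
        intro s hs
        rw [Finset.mem_range] at hs
        have : 2 * (n + 1) = 2 * (n + 1 - s) + 2 * s := by omega
        rw [this, pow_add]
        field_simp
      have h4 := tendsto_nhds_unique (h1.congr' h3) h2
      rw [Finset.sum_range_succ, Finset.sum_eq_zero] at h4
      · simpa using h4.symm
      · intro s hs
        rw [Finset.mem_range] at hs
        rw [zero_pow (by omega), mul_zero]
    intro s h1 h2
    rcases Nat.lt_or_ge n s with h | h'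
    · rw [show s = n + 1 by omega]; exact hB
    · apply ih _ s h1 h'
      simp_rw [Finset.sum_range_succ _ (n + 1), hB] at h
      simpa using h

/-- `(-1)^k * 2 * t k i` in a recursion friendly shape -/
lemma choose_rec (k i : ℕ) : Nat.choose (k + 2) (i + 2) + Nat.choose k (i + 2) =
    2 * Nat.choose (k + 1) (i + 2) + Nat.choose k i := by
  rw [Nat.choose_succ_succ' (k + 1) (i + 1), Nat.choose_succ_succ' k (i + 1), Nat.choose_succ_succ' k i]
  ring

/-- v k i = C(k+1+i,2i) + C(k+i,2i) -/
def vC (k i : ℕ) : ℕ := Nat.choose (k + 1 + i) (2 * i) + Nat.choose (k + i) (2 * i)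

lemma vC_zero_right (k : ℕ) : vC k 0 = 2 := by simp [vC]

lemma vC_rec (k i : ℕ) : vC (k + 2) (i + 1) + vC k (i + 1) = 2 * vC (k + 1) (i + 1) + vC (k + 1) i := by
  unfold vC
  have h1 := choose_rec (k + 1 + (i + 1)) (2 * i)
  have h2 := choose_rec (k + (i + 1)) (2 * i)
  rw [show 2 * (i + 1) = 2 * i + 2 by ring]
  ring_nf at h1 h2 ⊢
  omega

lemma tCoeff_vC (k i : ℕ) (hi : i ≤ k + 1) :
    2 * ((-1) ^ (k + 1) * tCoeff (k + 1) i) = (-1) ^ i * 4 ^ i * (vC k i : ℝ) := by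
  unfold tCoeff vC
  rw [if_neg (by omega)]
  have e1 : (k + 1 + i).choose (k + 1 - i) = (k + 1 + i).choose (2 * i) := by
    rw [← Nat.choose_symm (by omega)]
    congr 1; omega
  have e2 : (k + i).choose (2 * i) * (k + 1 + i) = (k + 1 + i).choose (2 * i) * (k + 1 - i) := by
    have := Nat.choose_mul_succ_eq (k + i) (2 * i)
    rw [show k + i + 1 = k + 1 + i by ring, show k + 1 + i - 2 * i = k + 1 - i by omega] at this
    exact this
  have e3 : ((k + i).choose (2 * i) : ℝ) = (k + 1 + i).choose (2 * i) * ((k : ℝ) + 1 - i) / (k + 1 + i) := by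
    rw [eq_div_iff (by positivity)]
    have : (((k + i).choose (2 * i) * (k + 1 + i) : ℕ) : ℝ) = ((k + 1 + i).choose (2 * i) * (k + 1 - i) : ℕ) := by
      rw [e2]
    rw [Nat.cast_mul, Nat.cast_mul, Nat.cast_sub hi] at this
    push_cast at this
    exact this
  have e4 : (-1 : ℝ) ^ (k + 1) * (-1) ^ (k + 1 - i) = (-1) ^ i := by
    rw [← pow_add]
    have : k + 1 + (k + 1 - i) = 2 * (k + 1 - i) + i := by omega
    rw [this, pow_add, pow_mul]; simp
  rw [e1]
  push_cast
  rw [e3, pow_mul]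
  rw [← e4]
  have : ((k : ℝ) + 1 + i) ≠ 0 := by positivity
  field_simp
  ring

lemma vC_big (k i : ℕ) (h : k + 1 < i) : vC k i = 0 := by
  unfold vC
  rw [Nat.choose_eq_zero_of_lt (by omega), Nat.choose_eq_zero_of_lt (by omega)]

noncomputable def vP (k M : ℕ) (y : ℝ) : ℝ := ∑ i ∈ Finset.range M, (vC k i : ℝ) * y ^ i

lemma vP_rec (k M : ℕ) (y : ℝ) (hM : k + 3 < M) : vP (k + 2) M y = (2 + y) * vP (k + 1) M y - vP k M y := by
  obtain ⟨M, rfl⟩ : ∃ N, M = N + 1 := ⟨M - 1, by omega⟩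
  have h1 : y * vP (k + 1) (M + 1) y = ∑ i ∈ Finset.range M, (vC (k + 1) i : ℝ) * y ^ (i + 1) := by
    unfold vP
    rw [Finset.sum_range_succ, vC_big (k + 1) M (by omega), mul_add, Finset.mul_sum]
    simp
    apply Finset.sum_congr rfl
    intro i _; ring
  rw [add_mul, h1]
  unfold vP
  rw [Finset.sum_range_succ', Finset.sum_range_succ', Finset.sum_range_succ', mul_add, Finset.mul_sum]
  simp only [vC_zero_right]
  have : ∀ i, (vC (k + 2) (i + 1) : ℝ) * y ^ (i + 1) = 2 * ((vC (k + 1) (i + 1) : ℝ) * y ^ (i + 1)) +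
      (vC (k + 1) i : ℝ) * y ^ (i + 1) - (vC k (i + 1) : ℝ) * y ^ (i + 1) := by
    intro i
    have h := vC_rec k i
    have h' : (vC (k + 2) (i + 1) : ℝ) + vC k (i + 1) = 2 * vC (k + 1) (i + 1) + vC (k + 1) i := by
      exact_mod_cast h
    linear_combination y ^ (i + 1) * h'
  rw [Finset.sum_congr rfl (fun i _ => this i), Finset.sum_sub_distrib, Finset.sum_add_distrib]
  ring

lemma vP_trunc (k M : ℕ) (y : ℝ) (hM : k + 2 ≤ M) : vP k M y = vP k (k + 2) y := by
  unfold vP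
  symm
  apply Finset.sum_subset
  · intro i; simp; omega
  · intro i _ h
    rw [Finset.mem_range] at h
    rw [vC_big k i (by omega)]; simp

lemma vP_cos (x : ℝ) (k : ℕ) : ∀ M, k + 2 ≤ M →
    vP k M (-4 * sin x ^ 2) = 2 * cos (2 * ((k + 1 : ℕ) : ℝ) * x) := by
  induction k using Nat.twoStepInduction with
  | zero =>
    intro M hM
    rw [vP_trunc _ _ _ hM]
    simp [vP, vC, Finset.sum_range_succ]
    rw [cos_two_mul, cos_sq']; ring
  | one =>
    intro M hM
    rw [vP_trunc _ _ _ hM]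
    simp [vP, vC, Finset.sum_range_succ, Nat.choose]
    rw [show (2 * 2 * x : ℝ) = 2 * (2 * x) by ring, cos_two_mul, cos_two_mul, cos_sq']; ring
  | more k ih1 ih2 =>
    intro M hM
    rw [vP_trunc _ _ _ hM, ← vP_trunc _ (k + 2 + 3) _ (by omega), vP_rec _ _ _ (by omega), ih1 _ (by omega), ih2 _ (by omega)]
    have e1 : (2 * ((k + 2 + 1 : ℕ) : ℝ) * x) = 2 * ((k + 1 + 1 : ℕ) : ℝ) * x + 2 * x := by push_cast; ring
    have e2 : (2 * ((k + 1 : ℕ) : ℝ) * x) = 2 * ((k + 1 + 1 : ℕ) : ℝ) * x - 2 * x := by push_cast; ring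
    rw [e1, e2, cos_add, cos_sub, show cos (2 * x) = 1 - 2 * sin x ^ 2 by rw [cos_two_mul, cos_sq']; ring]
    ring

/-- Chebyshev -/
lemma cheb (x : ℝ) (k : ℕ) : 2 * ((-1) ^ k * ∑ i ∈ Finset.range (k + 1), tCoeff k i * sin x ^ (2 * i)) =
    if k = 0 then 1 else 2 * cos (2 * (k : ℝ) * x) := by
  cases k with
  | zero => simp [tCoeff]
  | succ k =>
    rw [if_neg (by omega), ← vP_cos x k (k + 2) le_rfl]
    unfold vP
    rw [Finset.mul_sum, Finset.mul_sum]
    apply Finset.sum_congr rfl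
    intro i hi
    rw [Finset.mem_range] at hi
    have := tCoeff_vC k i (by omega)
    rw [show (-4 * sin x ^ 2) = (-1) * (4 * sin x ^ 2) by ring, mul_pow, mul_pow, pow_mul]
    linear_combination (sin x ^ 2) ^ i * this

lemma sum_aCoeff (n : ℕ) (hn : 1 ≤ n) (x : ℝ) (hx : sin x ≠ 0) :
    Hf (2 * n) x = ∑ j ∈ Finset.Icc 1 n, aCoeff n j * (1 / sin x ^ (2 * j)) := by
  have hin : ∀ l ∈ Finset.Icc 1 n,
      ∑ j ∈ Finset.Icc l n, tCoeff (n - l) (n - j) * (1 / sin x ^ (2 * j)) =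
      (∑ i ∈ Finset.range (n - l + 1), tCoeff (n - l) i * sin x ^ (2 * i)) / sin x ^ (2 * n) := by
    intro l hl
    rw [Finset.mem_Icc] at hl
    rw [Finset.sum_div]
    apply Finset.sum_bij' (fun j _ => n - j) (fun i _ => n - i)
    · intro j hj; simp at hj ⊢; omega
    · intro j hj; simp at hj ⊢; omega
    · intro j hj; simp at hj ⊢; omega
    · intro j hj; simp at hj ⊢; omega
    · intro j hj
      rw [Finset.mem_Icc] at hj
      have : 2 * n = 2 * (n - j) + 2 * j := by omega
      rw [this, pow_add]
      field_simp
  have h1 : ∑ j ∈ Finset.Icc 1 n, aCoeff n j * (1 / sin x ^ (2 * j)) =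
      ∑ l ∈ Finset.Icc 1 n, (circEulerian (2 * n) l : ℝ) * (2 * ((-1) ^ (n - l) *
        ∑ i ∈ Finset.range (n - l + 1), tCoeff (n - l) i * sin x ^ (2 * i))) / sin x ^ (2 * n) := by
    unfold aCoeff
    simp_rw [Finset.mul_sum, Finset.sum_mul]
    rw [Finset.sum_comm' (t' := Finset.Icc 1 n) (s' := fun l => Finset.Icc l n)]
    · apply Finset.sum_congr rfl
      intro l hl
      have := hin l hl
      simp_rw [← Finset.mul_sum]
      rw [mul_div_assoc, mul_div_assoc, mul_div_assoc, ← this, Finset.mul_sum, Finset.mul_sum,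
        Finset.mul_sum]
      apply Finset.sum_congr rfl
      intro j _
      ring
    · intro j l; simp; omega
  rw [h1, ← Finset.sum_div]
  unfold Hf
  congr 1
  rw [WF_even n hn]
  · rw [← Finset.Ico_succ_right_eq_Icc, Nat.succ_eq_succ, Finset.sum_Ico_succ_top hn, cheb, add_comm, Finset.mul_sum]
    congr 1
    · apply Finset.sum_congr rfl
      intro l hl
      rw [Finset.mem_Ico] at hl
      rw [cheb, if_neg (by omega), Nat.cast_sub (by omega)]
      push_cast
      rw [show (2 * (n : ℝ) - 2 * l) * x = 2 * ((n : ℝ) - l) * x by ring]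
      ring
    · simp
  · intro l hl
    rw [← cos_neg]
    congr 1
    rw [Nat.cast_sub hl]
    push_cast
    ring

/-- Let `c g s` be the coefficient of `x^{-2s}` in the Laurent expansion of `(sin x)^{-2g}` at
`0` (characterized by `1/sin^{2g} x - ∑_{s=0}^{g} c_{g,s} x^{-2s} → 0` as `x → 0`).  Then for
`n ≥ 1` and `1 ≤ s ≤ n`, `∑_{i=0}^{n-s} a_{n,n-i} c_{n-i,s}` equals `(2n-1)!` if `s = n` and
`0` if `1 ≤ s ≤ n-1`; i.e. `A · C = diag(1!, 3!, …, (2n-1)!)`. -/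
theorem aCoeff_mul_laurentCoeff_sum (c : ℕ → ℕ → ℝ)
    (hc : ∀ g : ℕ, 1 ≤ g →
      Filter.Tendsto
        (fun x : ℝ => 1 / Real.sin x ^ (2 * g) - ∑ s ∈ Finset.range (g + 1), c g s / x ^ (2 * s))
        (nhdsWithin 0 {0}ᶜ) (nhds 0))
    (n : ℕ) (hn : 1 ≤ n) (s : ℕ) (hs1 : 1 ≤ s) (hsn : s ≤ n) :
    ∑ i ∈ Finset.range (n - s + 1), aCoeff n (n - i) * c (n - i) s =
      if s = n then (Nat.factorial (2 * n - 1) : ℝ) else 0 := by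
  set B : ℕ → ℝ := fun s => (if s = n then (Nat.factorial (2 * n - 1) : ℝ) else 0) -
    ∑ j ∈ (Finset.Icc 1 n).filter (fun j => s ≤ j), aCoeff n j * c j s with hB
  obtain ⟨g, hg, hev⟩ := Hf_laurent (2 * n - 1)
  rw [show 2 * n - 1 + 1 = 2 * n by omega] at hev
  have ht0 : Tendsto (fun x : ℝ => ∑ j ∈ Finset.Icc 1 n, aCoeff n j *
      (1 / Real.sin x ^ (2 * j) - ∑ s ∈ Finset.range (j + 1), c j s / x ^ (2 * s)))
      (nhdsWithin 0 {0}ᶜ) (nhds (∑ j ∈ Finset.Icc 1 n, aCoeff n j * 0)) := by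
    apply tendsto_finsetSum
    intro j hj
    rw [Finset.mem_Icc] at hj
    exact (hc j hj.1).const_mul _
  have htg : Tendsto g (nhdsWithin 0 {0}ᶜ) (nhds (g 0)) :=
    hg.continuousAt.tendsto.mono_left nhdsWithin_le_nhds
  have ht := ht0.sub htg
  have hBs : B s = 0 := by
    refine laurent_unique n B _ (ht.congr' ?_) s hs1 hsn
    filter_upwards [hev, sin_ev] with x hx hsin
    have h1 := sum_aCoeff n hn x hsin
    simp_rw [mul_sub]
    rw [Finset.sum_sub_distrib, ← h1, hx]
    simp only [hB, sub_div]
    rw [Finset.sum_sub_distrib]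
    have e1 : ∑ s ∈ Finset.range (n + 1),
        (if s = n then (Nat.factorial (2 * n - 1) : ℝ) else 0) / x ^ (2 * s) =
        (Nat.factorial (2 * n - 1) : ℝ) / x ^ (2 * n) := by
      rw [Finset.sum_eq_single n]
      · simp
      · intro b _ hb; simp [hb]
      · intro h; simp at h
    have e2 : ∑ j ∈ Finset.Icc 1 n, aCoeff n j * ∑ s ∈ Finset.range (j + 1), c j s / x ^ (2 * s) =
        ∑ s ∈ Finset.range (n + 1),
          (∑ j ∈ (Finset.Icc 1 n).filter (fun j => s ≤ j), aCoeff n j * c j s) / x ^ (2 * s) := by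
      simp_rw [Finset.mul_sum, Finset.sum_div]
      rw [Finset.sum_comm' (t' := Finset.range (n + 1))
        (s' := fun s => (Finset.Icc 1 n).filter (fun j => s ≤ j))]
      · apply Finset.sum_congr rfl
        intro s _
        apply Finset.sum_congr rfl
        intro j _
        ring
      · intro j s; simp; omega
    rw [e1, e2]
    ring
  have hsum : ∑ i ∈ Finset.range (n - s + 1), aCoeff n (n - i) * c (n - i) s =
      ∑ j ∈ (Finset.Icc 1 n).filter (fun j => s ≤ j), aCoeff n j * c j s := by
    apply Finset.sum_bij' (fun i _ => n - i) (fun j _ => n - j)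
    · intro j hj; simp at hj ⊢; omega
    · intro j hj; simp at hj ⊢; omega
    · intro j hj; simp at hj ⊢; omega
    · intro j hj; simp at hj ⊢; omega
    · intro j _; rfl
  rw [hsum]
  simp only [hB] at hBs
  linarith
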